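/- Let ⟨ξ,π⟩ : E ⥤ A × B be a span. The following are equivalent: (i) for every morphism u : a → a' of A, every object b of B and every object e with ξ e = a and π e = b, there is a ⟨ξ,π⟩-opcartesian morphism f : e → e' with ⟨ξ,π⟩ f = (u, id_b); equivalently, ⟨ξ,π⟩ is a cocartesian fibration sliced over B with respect to π and the projection A × B ⥤ B; (ii) the span is cocartesian on the left; (iii) letting ξ↓A be the category whose objects are pairs (e, u : ξ e → a') and whose morphisms (e,u) → (e₀,u₀) are pairs (m : e → e₀, w : a' → a₀') with u₀ ∘ ξ m = w ∘ u, equipped with the projection to A × B given by (e, u : ξe → a') ↦ (a', π e), the functor ι_ξ : E ⥤ ξ↓A, e ↦ (e, id_{ξ e}), admits a left adjoint τ_ξ commuting with the projections to A × B whose unit and counit are sent to identity natural transformations by the projections to A × B. (One-categorical characterization of spans that are cocartesian on the left.) -/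

import Mathlib

open CategoryTheory

universe w v₁ u₁ v₂ u₂ v₃ u₃ v₄ u₄ v₅ u₅ v₆ u₆

section BasicDefs

variable {E : Type u₁} [Category.{v₁} E] {B : Type u₂} [Category.{v₂} B]
  {A : Type u₃} [Category.{v₃} A]

/-- `f` is a `π`-opcartesian morphism. -/
def IsOpcartesianMor (π : E ⥤ B) {e e' : E} (f : e ⟶ e') : Prop :=
  ∀ ⦃e'' : E⦄ (g : e ⟶ e'') (w : π.obj e' ⟶ π.obj e''),
    π.map f ≫ w = π.map g → ∃! h : e' ⟶ e'', π.map h = w ∧ f ≫ h = g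

/-- `f` is a `π`-cartesian morphism. -/
def IsCartesianMor (π : E ⥤ B) {e' e : E} (f : e' ⟶ e) : Prop :=
  ∀ ⦃e'' : E⦄ (g : e'' ⟶ e) (w : π.obj e'' ⟶ π.obj e'),
    w ≫ π.map f = π.map g → ∃! h : e'' ⟶ e', π.map h = w ∧ h ≫ f = g

/-- `f` is `π`-vertical, i.e. `π` sends it to an identity. -/
def IsVerticalMor (π : E ⥤ B) {e e' : E} (f : e ⟶ e') : Prop :=
  ∃ h : π.obj e = π.obj e', π.map f = eqToHom h

/-- `π` is a Grothendieck opfibration. -/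
def IsGrothendieckOpfib (π : E ⥤ B) : Prop :=
  ∀ (e : E) ⦃b : B⦄ (u : π.obj e ⟶ b),
    ∃ (e' : E) (f : e ⟶ e') (hb : π.obj e' = b),
      IsOpcartesianMor π f ∧ π.map f ≫ eqToHom hb = u

/-- `π` is a Grothendieck fibration. -/
def IsGrothendieckFib (π : E ⥤ B) : Prop :=
  ∀ (e : E) ⦃b : B⦄ (v : b ⟶ π.obj e),
    ∃ (e' : E) (f : e' ⟶ e) (hb : π.obj e' = b),
      IsCartesianMor π f ∧ eqToHom hb.symm ≫ π.map f = v

/-- `φ` is a cocartesian fibration sliced over the base of `π`. -/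
def IsSlicedCocartFib {F : Type u₄} [Category.{v₄} F] (π : E ⥤ B) (φ : F ⥤ E) : Prop :=
  ∀ (x : F) (e : E) (k : φ.obj x ⟶ e), IsVerticalMor π k →
    ∃ (x' : F) (f : x ⟶ x') (he : φ.obj x' = e),
      IsOpcartesianMor φ f ∧ φ.map f ≫ eqToHom he = k

/-- The span `⟨ξ,π⟩` is cocartesian on the left. -/
def CocartOnLeft (ξ : E ⥤ A) (π : E ⥤ B) : Prop :=
  ∀ (e : E) ⦃a' : A⦄ (u : ξ.obj e ⟶ a'),
    ∃ (e' : E) (f : e ⟶ e') (ha : ξ.obj e' = a'),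
      IsOpcartesianMor ξ f ∧ IsVerticalMor π f ∧ ξ.map f ≫ eqToHom ha = u

/-- The span `⟨ξ,π⟩` is cartesian on the right. -/
def CartOnRight (ξ : E ⥤ A) (π : E ⥤ B) : Prop :=
  ∀ (e : E) ⦃b' : B⦄ (v : b' ⟶ π.obj e),
    ∃ (e' : E) (f : e' ⟶ e) (hb : π.obj e' = b'),
      IsCartesianMor π f ∧ IsVerticalMor ξ f ∧ eqToHom hb.symm ≫ π.map f = v

/-- `f` and `g` lie over the same arrow of the base (up to `eqToHom`). -/
def OverSameArrow (ξ : E ⥤ A) {x y x' y' : E} (f : x ⟶ y) (g : x' ⟶ y') : Prop :=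
  ∃ (p : ξ.obj x = ξ.obj x') (q : ξ.obj y = ξ.obj y'),
    ξ.map f ≫ eqToHom q = eqToHom p ≫ ξ.map g

/-- Cocartesian and cartesian lifts commute: every comparison morphism
`h : u_!(v^* e) ⟶ v^*(u_! e)` is an isomorphism. -/
def LiftsCommute (ξ : E ⥤ A) (π : E ⥤ B) : Prop :=
  ∀ ⦃e e₁ e₂ e₃ e₄ : E⦄ (k : e ⟶ e₁) (k' : e₂ ⟶ e) (f : e₂ ⟶ e₃) (f' : e₄ ⟶ e₁)
    (g : e₃ ⟶ e₁) (h : e₃ ⟶ e₄),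
    IsOpcartesianMor ξ k → IsVerticalMor π k →
    IsCartesianMor π k' → IsVerticalMor ξ k' →
    IsOpcartesianMor ξ f → IsVerticalMor π f → OverSameArrow ξ f k →
    IsCartesianMor π f' → IsVerticalMor ξ f' → OverSameArrow π f' k' →
    IsVerticalMor ξ g → f ≫ g = k' ≫ k →
    IsVerticalMor ξ h → IsVerticalMor π h → h ≫ f' = g →
    IsIso h

/-- Two-sided (cartesian) fibration. -/
def IsTwoSidedFib (ξ : E ⥤ A) (π : E ⥤ B) : Prop :=
  CocartOnLeft ξ π ∧ CartOnRight ξ π ∧ LiftsCommute ξ π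

end BasicDefs

section Statement7

variable {E : Type u₁} [Category.{v₁} E] {A : Type u₂} [Category.{v₂} A]
  {B : Type u₃} [Category.{v₃} B]

/-- The projection `ξ↓A = Comma ξ (𝟭 A) ⥤ A × B`, `(e, u : ξ e ⟶ a') ↦ (a', π e)`. -/
def commaToProd (ξ : E ⥤ A) (π : E ⥤ B) : Comma ξ (𝟭 A) ⥤ A × B where
  obj X := (X.right, π.obj X.left)
  map f := (f.right, π.map f.left)
  map_id X := by dsimp; simp
  map_comp f g := by dsimp; simp

/-- The canonical inclusion `ι_ξ : E ⥤ Comma ξ (𝟭 A)`, `e ↦ (e, ξ e, id)`. -/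
def slicedIota (ξ : E ⥤ A) : E ⥤ Comma ξ (𝟭 A) where
  obj e := { left := e, right := ξ.obj e, hom := 𝟙 _ }
  map f := { left := f, right := ξ.map f, w := by simp }

/-- If `f` is `π`-vertical, it is `⟨ξ,π⟩`-opcartesian exactly when it is `ξ`-opcartesian. -/
theorem isOpcartesianMor_prod'_iff (ξ : E ⥤ A) (π : E ⥤ B) {e e' : E} {f : e ⟶ e'}
    (hf : IsVerticalMor π f) :
    IsOpcartesianMor (ξ.prod' π) f ↔ IsOpcartesianMor ξ f := by
  obtain ⟨p, hp⟩ := hf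
  constructor
  · intro H e'' g w hw
    obtain ⟨h, ⟨h₁, h₂⟩, huniq⟩ := H g (w, eqToHom p.symm ≫ π.map g)
      (Prod.ext hw (by simp [hp]))
    refine ⟨h, ⟨congrArg Prod.fst h₁, h₂⟩, fun k hk => huniq k ⟨Prod.ext hk.1 ?_, hk.2⟩⟩
    simp [← hk.2, hp]
  · intro H e'' g w hw
    obtain ⟨h, ⟨h₁, h₂⟩, huniq⟩ := H g w.1 (congrArg Prod.fst hw)
    refine ⟨h, ⟨Prod.ext h₁ ?_, h₂⟩, fun k hk => huniq k ⟨congrArg Prod.fst hk.1, hk.2⟩⟩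
    have hw₂ : π.map f ≫ w.2 = π.map g := congrArg Prod.snd hw
    rw [← h₂, π.map_comp, hp] at hw₂
    exact ((cancel_epi _).1 hw₂).symm

/-- The morphism `X ⟶ ι_ξ e'` with components `f` and `r`. -/
def homSlicedIota {ξ : E ⥤ A} {X : Comma ξ (𝟭 A)} {e' : E} (f : X.left ⟶ e')
    (r : X.right ⟶ ξ.obj e') (w : ξ.map f = X.hom ≫ r) : X ⟶ (slicedIota ξ).obj e' where
  left := f
  right := r
  w := (Category.comp_id (ξ.map f)).trans w

theorem exists_eq_homSlicedIota {ξ : E ⥤ A} {X : Comma ξ (𝟭 A)} {e' : E}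
    (φ : X ⟶ (slicedIota ξ).obj e') :
    ∃ (f : X.left ⟶ e') (r : X.right ⟶ ξ.obj e') (w : ξ.map f = X.hom ≫ r),
      φ = homSlicedIota f r w :=
  ⟨φ.left, φ.right, (Category.comp_id (ξ.map φ.left)).symm.trans φ.w, rfl⟩

theorem homSlicedIota_comp_map_eq_iff {ξ : E ⥤ A} {X : Comma ξ (𝟭 A)} {e' e'' : E}
    {f : X.left ⟶ e'} {r : X.right ⟶ ξ.obj e'} (w : ξ.map f = X.hom ≫ r)
    {g : X.left ⟶ e''} {s : X.right ⟶ ξ.obj e''} (w' : ξ.map g = X.hom ≫ s) (h : e' ⟶ e'') :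
    homSlicedIota f r w ≫ (slicedIota ξ).map h = homSlicedIota g s w' ↔
      f ≫ h = g ∧ r ≫ ξ.map h = s :=
  ⟨fun H => ⟨congrArg CommaMorphism.left H, congrArg CommaMorphism.right H⟩,
    fun H => CommaMorphism.ext H.1 H.2⟩

/-- A morphism to `ι_ξ e'` with invertible right component is universal from its source to `ι_ξ`
exactly when its left component is `ξ`-opcartesian. -/
theorem isOpcartesianMor_iff_bijective {ξ : E ⥤ A} {X : Comma ξ (𝟭 A)} {e' : E}
    {f : X.left ⟶ e'} {r : X.right ⟶ ξ.obj e'} [IsIso r] (w : ξ.map f = X.hom ≫ r) :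
    IsOpcartesianMor ξ f ↔ ∀ e'' : E,
      Function.Bijective fun h : e' ⟶ e'' => homSlicedIota f r w ≫ (slicedIota ξ).map h := by
  simp only [Function.bijective_iff_existsUnique]
  constructor
  · intro H e'' φ
    obtain ⟨g, s, w', rfl⟩ := exists_eq_homSlicedIota φ
    obtain ⟨h, ⟨h₁, h₂⟩, huniq⟩ := H g (inv r ≫ s) (by simp [w, w'])
    simp only [homSlicedIota_comp_map_eq_iff]
    refine ⟨h, ⟨h₂, by simp [h₁]⟩, fun k hk => huniq k ⟨by simp [← hk.2], hk.1⟩⟩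
  · intro H e'' g v hv
    obtain ⟨h, hh, huniq⟩ := H e'' (homSlicedIota g (r ≫ v) (by simp [← hv, w]))
    simp only [homSlicedIota_comp_map_eq_iff] at hh huniq
    exact ⟨h, ⟨(cancel_epi r).1 hh.2, hh.1⟩, fun k hk => huniq k ⟨hk.2, by rw [hk.1]⟩⟩

theorem isVerticalMor_homSlicedIota_iff {ξ : E ⥤ A} (π : E ⥤ B) {X : Comma ξ (𝟭 A)} {e' : E}
    {f : X.left ⟶ e'} {r : X.right ⟶ ξ.obj e'} (w : ξ.map f = X.hom ≫ r) :
    IsVerticalMor (commaToProd ξ π) (homSlicedIota f r w) ↔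
      (∃ h : X.right = ξ.obj e', r = eqToHom h) ∧ IsVerticalMor π f := by
  constructor
  · rintro ⟨h, hφ⟩
    exact ⟨⟨congrArg Prod.fst h, (congrArg Prod.fst hφ).trans (eqToHom_fst h)⟩,
      ⟨congrArg Prod.snd h, (congrArg Prod.snd hφ).trans (eqToHom_snd h)⟩⟩
  · rintro ⟨⟨h₁, hφ₁⟩, h₂, hφ₂⟩
    have h : (commaToProd ξ π).obj X = (commaToProd ξ π).obj ((slicedIota ξ).obj e') :=
      Prod.ext h₁ h₂
    exact ⟨h, Prod.ext (hφ₁.trans (eqToHom_fst h).symm) (hφ₂.trans (eqToHom_snd h).symm)⟩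

/-- A left adjoint of `ι_ξ` whose unit is vertical over `A × B` commutes with the projections. -/
theorem comp_prod'_eq_commaToProd (ξ : E ⥤ A) (π : E ⥤ B) {τ : Comma ξ (𝟭 A) ⥤ E}
    (adj : τ ⊣ slicedIota ξ)
    (hunit : ∀ X, IsVerticalMor (commaToProd ξ π) (adj.unit.app X)) :
    τ ⋙ ξ.prod' π = commaToProd ξ π := by
  choose p hp using hunit
  refine CategoryTheory.Functor.ext (fun X => (p X).symm) fun X Y φ => ?_
  have hnat : (commaToProd ξ π).map φ ≫ (commaToProd ξ π).map (adj.unit.app Y) =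
      (commaToProd ξ π).map (adj.unit.app X) ≫ (τ ⋙ ξ.prod' π).map φ := by
    rw [← Functor.map_comp]
    exact (congrArg (commaToProd ξ π).map (adj.unit.naturality φ)).trans
      ((commaToProd ξ π).map_comp _ _)
  rw [hp, hp] at hnat
  exact (eqToHom_comp_iff (p X) _ _).1 hnat.symm

/-- If the unit of an adjunction `τ ⊣ ι_ξ` is vertical over `A × B`, so is the counit. -/
theorem isVerticalMor_counit (ξ : E ⥤ A) (π : E ⥤ B) {τ : Comma ξ (𝟭 A) ⥤ E}
    (adj : τ ⊣ slicedIota ξ)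
    (hunit : ∀ X, IsVerticalMor (commaToProd ξ π) (adj.unit.app X)) (e : E) :
    IsVerticalMor (ξ.prod' π) (adj.counit.app e) := by
  obtain ⟨p, hp⟩ := hunit ((slicedIota ξ).obj e)
  refine ⟨p.symm, ?_⟩
  have h : (commaToProd ξ π).map (adj.unit.app ((slicedIota ξ).obj e)) ≫
      (ξ.prod' π).map (adj.counit.app e) = 𝟙 _ :=
    ((commaToProd ξ π).map_comp _ ((slicedIota ξ).map (adj.counit.app e))).symm.trans
      ((congrArg (commaToProd ξ π).map (adj.right_triangle_components e)).trans
        ((commaToProd ξ π).map_id _))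
  rw [hp] at h
  exact ((eqToHom_comp_iff p _ _).1 h).trans (Category.comp_id _)

theorem CocartOnLeft.exists_universal {ξ : E ⥤ A} {π : E ⥤ B} (H : CocartOnLeft ξ π)
    (X : Comma ξ (𝟭 A)) :
    ∃ (e' : E) (η : X ⟶ (slicedIota ξ).obj e'), IsVerticalMor (commaToProd ξ π) η ∧
      ∀ e'' : E, Function.Bijective fun h : e' ⟶ e'' => η ≫ (slicedIota ξ).map h := by
  obtain ⟨e', f, ha, hf, hv, hu⟩ := H X.left X.hom
  have w := (comp_eqToHom_iff ha _ _).1 hu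
  exact ⟨e', homSlicedIota f (eqToHom ha.symm) w,
    (isVerticalMor_homSlicedIota_iff π w).2 ⟨⟨ha.symm, rfl⟩, hv⟩,
    (isOpcartesianMor_iff_bijective w).1 hf⟩

theorem CocartOnLeft.exists_adjunction {ξ : E ⥤ A} {π : E ⥤ B} (H : CocartOnLeft ξ π) :
    ∃ (τ : Comma ξ (𝟭 A) ⥤ E) (adj : τ ⊣ slicedIota ξ),
      ∀ X, IsVerticalMor (commaToProd ξ π) (adj.unit.app X) := by
  choose obj η hη hbij using H.exists_universal
  let equiv (X e) : (obj X ⟶ e) ≃ (X ⟶ (slicedIota ξ).obj e) :=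
    Equiv.ofBijective _ (hbij X e)
  refine ⟨_, Adjunction.adjunctionOfEquivLeft equiv fun X e e' g h => ?_, fun X => ?_⟩
  · simp [equiv]
  · have : equiv X (obj X) (𝟙 _) = η X := by simp [equiv]
    simpa [this] using hη X

theorem CocartOnLeft.of_adjunction {ξ : E ⥤ A} {π : E ⥤ B} {τ : Comma ξ (𝟭 A) ⥤ E}
    (adj : τ ⊣ slicedIota ξ)
    (hunit : ∀ X, IsVerticalMor (commaToProd ξ π) (adj.unit.app X)) : CocartOnLeft ξ π := by
  intro e a' u
  let X : Comma ξ (𝟭 A) := { left := e, right := a', hom := u }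
  obtain ⟨f, r, w, hη⟩ := exists_eq_homSlicedIota (adj.unit.app X)
  obtain ⟨⟨ha, rfl⟩, hv⟩ := (isVerticalMor_homSlicedIota_iff π w).1 (hη ▸ hunit X)
  refine ⟨τ.obj X, f, ha.symm, (isOpcartesianMor_iff_bijective w).2 fun e'' => ?_, hv,
    (comp_eqToHom_iff ha.symm _ _).2 w⟩
  rw [← hη]
  exact (funext fun h => adj.homEquiv_unit X e'' h : ⇑(adj.homEquiv X e'') = _) ▸
    (adj.homEquiv X e'').bijective

theorem isSlicedCocartFib_snd_prod'_iff (ξ : E ⥤ A) (π : E ⥤ B) :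
    IsSlicedCocartFib (CategoryTheory.Prod.snd A B) (ξ.prod' π) ↔
      ∀ (e : E) ⦃a' : A⦄ (u : ξ.obj e ⟶ a'),
        ∃ (e' : E) (f : e ⟶ e') (ha : ξ.obj e' = a'),
          IsOpcartesianMor (ξ.prod' π) f ∧ IsVerticalMor π f ∧ ξ.map f ≫ eqToHom ha = u := by
  constructor
  · intro H e a' u
    obtain ⟨e', f, he, hf, hk⟩ := H e (a', π.obj e) (u, 𝟙 _) ⟨rfl, rfl⟩
    have h₁ : ξ.map f ≫ (eqToHom he).1 = u := congrArg Prod.fst hk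
    have h₂ : π.map f ≫ (eqToHom he).2 = 𝟙 _ := congrArg Prod.snd hk
    rw [eqToHom_fst] at h₁
    rw [eqToHom_snd, comp_eqToHom_iff, Category.id_comp] at h₂
    exact ⟨e', f, congrArg Prod.fst he, hf, ⟨_, h₂⟩, h₁⟩
  · rintro H e ⟨a', b'⟩ ⟨u, v⟩ ⟨hb, hv⟩
    obtain ⟨e', f, ha, hf, ⟨p, hp⟩, hu⟩ := H e u
    change v = eqToHom hb at hv
    have he : (ξ.prod' π).obj e' = (a', b') := Prod.ext ha (p.symm.trans hb)
    refine ⟨e', f, he, hf, Prod.ext ?_ ?_⟩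
    · change ξ.map f ≫ (eqToHom he).1 = u
      rw [eqToHom_fst]
      exact hu
    · change π.map f ≫ (eqToHom he).2 = v
      rw [eqToHom_snd, hp, hv]
      exact eqToHom_trans _ _

/-- **Characterization of spans cocartesian on the left.** For a span
`⟨ξ,π⟩ : E ⥤ A × B` the following are equivalent: (i) every `u : a ⟶ a'` and object
`e` over `(a,b)` admit a `⟨ξ,π⟩`-opcartesian lift over `(u, 𝟙 b)`; (i')
`⟨ξ,π⟩` is a cocartesian fibration sliced over `B` with respect to `π` and the
projection `A × B ⥤ B`; (ii) the span is cocartesian on the left; (iii) the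
inclusion `ι_ξ : E ⥤ ξ↓A` admits a fibered left adjoint over `A × B`. -/
theorem cocartOnLeft_characterization (ξ : E ⥤ A) (π : E ⥤ B) :
    List.TFAE
      [ -- (i) opcartesian lifts over `(u, id_b)`
        (∀ (e : E) ⦃a' : A⦄ (u : ξ.obj e ⟶ a'),
          ∃ (e' : E) (f : e ⟶ e') (ha : ξ.obj e' = a'),
            IsOpcartesianMor (ξ.prod' π) f ∧ IsVerticalMor π f ∧
            ξ.map f ≫ eqToHom ha = u),
        -- (i') sliced cocartesian fibration over `B`
        IsSlicedCocartFib (CategoryTheory.Prod.snd A B) (ξ.prod' π),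
        -- (ii) cocartesian on the left
        CocartOnLeft ξ π,
        -- (iii) fibered left adjoint of `ι_ξ` over `A × B`
        (∃ (τ : Comma ξ (𝟭 A) ⥤ E) (adj : τ ⊣ slicedIota ξ),
          τ ⋙ ξ.prod' π = commaToProd ξ π ∧
          (∀ X : Comma ξ (𝟭 A), IsVerticalMor (commaToProd ξ π) (adj.unit.app X)) ∧
          (∀ e : E, IsVerticalMor (ξ.prod' π) (adj.counit.app e))) ] := by
  tfae_have 1 ↔ 2 := (isSlicedCocartFib_snd_prod'_iff ξ π).symm
  tfae_have 1 → 3 := fun H e a' u =>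
    let ⟨e', f, ha, hf, hv, hu⟩ := H e u
    ⟨e', f, ha, (isOpcartesianMor_prod'_iff ξ π hv).1 hf, hv, hu⟩
  tfae_have 3 → 1 := fun H e a' u =>
    let ⟨e', f, ha, hf, hv, hu⟩ := H e u
    ⟨e', f, ha, (isOpcartesianMor_prod'_iff ξ π hv).2 hf, hv, hu⟩
  tfae_have 3 → 4 := fun H =>
    let ⟨τ, adj, hunit⟩ := H.exists_adjunction
    ⟨τ, adj, comp_prod'_eq_commaToProd ξ π adj hunit, hunit,
      isVerticalMor_counit ξ π adj hunit⟩
  tfae_have 4 → 3 := fun ⟨_, adj, _, hunit, _⟩ => CocartOnLeft.of_adjunction adj hunit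
  tfae_finish

end Statement7
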